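/- arXiv:1603.08232 — 3 statements merged into one kernel-verified Lean document; each statement's English description precedes it below -/
import Mathlib

section
/- Let G be an ℕ-valued random variable with P(G ≥ g) > 0 for every g ≥ 1, and let (c_g)_{g≥1} be a summable sequence of nonnegative real numbers. Then E[ Σ_{g=1}^G c_g / P(G ≥ g) ] = Σ_{g=1}^∞ c_g. -/
open MeasureTheory ProbabilityTheory

/-- Rhee–Glynn debiasing identity: if `G` is an `ℕ`-valued random variable with
`P(G ≥ g) > 0` for every `g ≥ 1` and `(c_g)` is a summable sequence of nonnegative reals,
then `E[Σ_{g=1}^G c_g / P(G ≥ g)] = Σ_{g=1}^∞ c_g`. -/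
theorem rhee_glynn_debiasing_identity
    {Ω : Type*} [MeasurableSpace Ω] (μ : Measure Ω) [IsProbabilityMeasure μ]
    (G : Ω → ℕ) (hGmeas : Measurable G)
    (hpos : ∀ g : ℕ, 1 ≤ g → 0 < μ {ω | g ≤ G ω})
    (c : ℕ → ℝ) (hc : ∀ g, 0 ≤ c g) (hsum : Summable c) :
    ∫ ω, (∑ g ∈ Finset.Icc 1 (G ω), c g / (μ {ω' | g ≤ G ω'}).toReal) ∂μ =
      ∑' g : ℕ, c (g + 1) := by
  set F : ℕ → Ω → ℝ := fun i => {ω | i + 1 ≤ G ω}.indicator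
    fun _ => c (i + 1) / (μ {ω' | i + 1 ≤ G ω'}).toReal with hF
  have hmeas (i : ℕ) : MeasurableSet {ω | i + 1 ≤ G ω} :=
    measurableSet_le measurable_const hGmeas
  have hint (i : ℕ) : Integrable (F i) μ := (integrable_const _).indicator (hmeas i)
  have hval (i : ℕ) : ∫ ω, F i ω ∂μ = c (i + 1) := by
    have hne : (μ {ω | i + 1 ≤ G ω}).toReal ≠ 0 :=
      (ENNReal.toReal_pos (hpos (i + 1) (by lia)).ne' (measure_ne_top _ _)).ne'
    rw [hF, integral_indicator_const _ (hmeas i), smul_eq_mul, Measure.real,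
      mul_div_cancel₀ _ hne]
  have hnorm (i : ℕ) (ω : Ω) : ‖F i ω‖ = F i ω :=
    Real.norm_of_nonneg <|
      Set.indicator_nonneg (fun _ _ => div_nonneg (hc _) ENNReal.toReal_nonneg) ω
  have hpt (ω : Ω) : ∑ g ∈ Finset.Icc 1 (G ω), c g / (μ {ω' | g ≤ G ω'}).toReal =
      ∑' i, F i ω := by
    rw [tsum_eq_sum (s := Finset.range (G ω))]
    · rw [← Finset.Ico_add_one_right_eq_Icc, Finset.sum_Ico_eq_sum_range, Nat.add_sub_cancel]
      refine Finset.sum_congr rfl fun i hi => ?_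
      have hi' : ω ∈ {ω | i + 1 ≤ G ω} := Finset.mem_range.mp hi
      simp only [hF, Set.indicator_of_mem hi', add_comm 1 i]
    · intro i hi
      have hi' : ω ∉ {ω | i + 1 ≤ G ω} := fun h => hi (Finset.mem_range.mpr h)
      simp only [hF, Set.indicator_of_notMem hi']
  have hsummable : Summable fun i => ∫ ω, ‖F i ω‖ ∂μ := by
    simpa only [hnorm, hval] using (summable_nat_add_iff 1).mpr hsum
  simp only [hpt, ← hval]
  exact (integral_tsum_of_summable_integral_norm hint hsummable).symm
end

section
/- Let c > 0. The function f : (0, ∞) → ℝ given by f(λ) = λ + c/λ satisfies f(λ) ≥ 2√c for all λ > 0, with equality if and only if λ = √c. Consequently, for fixed q, a, d, σ_b ∈ ℝ with c = σ_b² + (d − a)² > 0, the variance formula V(λ) = exp(2(q + a))( exp(λ + c/λ) − exp(2(d − a)) ) of the Poisson likelihood estimator is minimized over λ ∈ (0, ∞) exactly at λ = √(σ_b² + (d − a)²). -/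
open Real

theorem add_div_sub_two_mul_sqrt {c x : ℝ} (hc : 0 ≤ c) (hx : x ≠ 0) :
    x + c / x - 2 * √c = (x - √c) ^ 2 / x := by
  field_simp
  linear_combination -Real.sq_sqrt hc

theorem two_mul_sqrt_le_add_div {c x : ℝ} (hc : 0 ≤ c) (hx : 0 < x) :
    2 * √c ≤ x + c / x := by
  rw [← sub_nonneg, add_div_sub_two_mul_sqrt hc hx.ne']
  positivity

theorem add_div_eq_two_mul_sqrt_iff {c x : ℝ} (hc : 0 ≤ c) (hx : x ≠ 0) :
    x + c / x = 2 * √c ↔ x = √c := by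
  rw [← sub_eq_zero, add_div_sub_two_mul_sqrt hc hx]
  simp [hx, sub_eq_zero]

/-- For `c > 0`, the map `λ ↦ λ + c/λ` on `(0, ∞)` is at least `2√c`, with equality iff
`λ = √c`; consequently, with `c = σ_b² + (d − a)²`, the Poisson-estimator variance
`V(λ) = exp(2(q + a))(exp(λ + c/λ) − exp(2(d − a)))` is minimized over `λ > 0` exactly at
`λ = √(σ_b² + (d − a)²)`. -/
theorem optimal_poisson_rate
    (c : ℝ) (hc : 0 < c) (q a d sb : ℝ) (hcdef : c = sb ^ 2 + (d - a) ^ 2) :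
    (∀ lam : ℝ, 0 < lam → 2 * Real.sqrt c ≤ lam + c / lam) ∧
    (∀ lam : ℝ, 0 < lam → (lam + c / lam = 2 * Real.sqrt c ↔ lam = Real.sqrt c)) ∧
    (∀ lam : ℝ, 0 < lam →
      Real.exp (2 * (q + a)) *
          (Real.exp (Real.sqrt (sb ^ 2 + (d - a) ^ 2) +
            c / Real.sqrt (sb ^ 2 + (d - a) ^ 2)) - Real.exp (2 * (d - a))) ≤
        Real.exp (2 * (q + a)) * (Real.exp (lam + c / lam) - Real.exp (2 * (d - a)))) ∧
    (∀ lam : ℝ, 0 < lam →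
      Real.exp (2 * (q + a)) * (Real.exp (lam + c / lam) - Real.exp (2 * (d - a))) =
        Real.exp (2 * (q + a)) *
          (Real.exp (Real.sqrt (sb ^ 2 + (d - a) ^ 2) +
            c / Real.sqrt (sb ^ 2 + (d - a) ^ 2)) - Real.exp (2 * (d - a))) →
      lam = Real.sqrt (sb ^ 2 + (d - a) ^ 2)) := by
  have h_min : √c + c / √c = 2 * √c :=
    (add_div_eq_two_mul_sqrt_iff hc.le (Real.sqrt_pos.2 hc).ne').2 rfl
  rw [← hcdef, h_min]
  refine ⟨fun _ h => two_mul_sqrt_le_add_div hc.le h,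
    fun _ h => add_div_eq_two_mul_sqrt_iff hc.le h.ne', fun lam h => ?_, fun lam h heq => ?_⟩
  · gcongr
    exact two_mul_sqrt_le_add_div hc.le h
  · have h_exp := sub_left_injective (mul_left_cancel₀ (Real.exp_ne_zero _) heq)
    exact (add_div_eq_two_mul_sqrt_iff hc.le h.ne').1 (Real.exp_injective h_exp)
end

section
/- Let λ > 0 and q, d, σ_b ∈ ℝ. The function V : ℝ → ℝ given by V(a) = exp(2(q + a))( exp(λ + (σ_b² + (d − a)²)/λ) − exp(2(d − a)) ) satisfies V(a) = exp(2(q + d))( exp(−2(d − a) + λ + (σ_b² + (d − a)²)/λ) − 1 ) for all a, and attains its unique global minimum over a ∈ ℝ at a = d − λ. -/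
/-- The variance of the Poisson likelihood estimator as a function of the lower bound `a`:
`V(a) = exp(2(q + a))(exp(λ + (σ_b² + (d − a)²)/λ) − exp(2(d − a)))`. -/
noncomputable def poissonEstimatorVariance (lam q d sb a : ℝ) : ℝ :=
  Real.exp (2 * (q + a)) *
    (Real.exp (lam + (sb ^ 2 + (d - a) ^ 2) / lam) - Real.exp (2 * (d - a)))

/-- Completing the square in the exponent of the variance of the Poisson likelihood estimator. -/
theorem poissonEstimatorVariance_eq_completed_square
    (lam q d sb : ℝ) (hlam : lam ≠ 0) (a : ℝ) :
    poissonEstimatorVariance lam q d sb a =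
      Real.exp (2 * (q + d)) *
        (Real.exp ((sb ^ 2 + (a - (d - lam)) ^ 2) / lam) - 1) := by
  unfold poissonEstimatorVariance
  rw [mul_sub, mul_sub (Real.exp (2 * (q + d))), ← Real.exp_add, ← Real.exp_add, ← Real.exp_add,
    mul_one]
  congr 2
  · field_simp
    ring
  · ring

/-- The variance `V(a)` of the Poisson likelihood estimator rewrites as
`exp(2(q + d))(exp(−2(d − a) + λ + (σ_b² + (d − a)²)/λ) − 1)` and attains its unique
global minimum over `a ∈ ℝ` at `a = d − λ`. -/
theorem optimal_lower_bound
    (lam q d sb : ℝ) (hlam : 0 < lam) :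
    (∀ a : ℝ, poissonEstimatorVariance lam q d sb a =
      Real.exp (2 * (q + d)) *
        (Real.exp (-(2 * (d - a)) + lam + (sb ^ 2 + (d - a) ^ 2) / lam) - 1)) ∧
    (∀ a : ℝ, poissonEstimatorVariance lam q d sb (d - lam) ≤
      poissonEstimatorVariance lam q d sb a) ∧
    (∀ a : ℝ, poissonEstimatorVariance lam q d sb a =
      poissonEstimatorVariance lam q d sb (d - lam) → a = d - lam) := by
  have hV := poissonEstimatorVariance_eq_completed_square lam q d sb hlam.ne'
  refine ⟨fun a => ?_, fun a => ?_, fun a h => ?_⟩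
  · rw [hV]
    congr 3
    field_simp
    ring
  · rw [hV, hV, sub_self]
    gcongr Real.exp _ * (Real.exp ((_ + ?_) / _) - _)
    simpa only [zero_pow two_ne_zero] using sq_nonneg (a - (d - lam))
  · rw [hV, hV, mul_right_inj' (Real.exp_ne_zero _), sub_left_inj, Real.exp_eq_exp,
      div_left_inj' hlam.ne', sub_self, add_right_inj, zero_pow two_ne_zero] at h
    exact sub_eq_zero.mp (pow_eq_zero_iff two_ne_zero |>.mp h)
end
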